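/- For polytopes P_1, …, P_n in R^n and nonnegative reals λ_1, …, λ_n, the function (λ_1, …, λ_n) ↦ Vol_n(λ_1 P_1 + … + λ_n P_n) is a homogeneous polynomial of degree n in λ_1, …, λ_n. -/

import Mathlib

open Pointwise MeasureTheory MvPolynomial

/-- A polytope: the convex hull of a nonempty finite set. -/
def IsPolytope {V : Type*} [AddCommGroup V] [Module ℝ V] (P : Set V) : Prop :=
  ∃ S : Finset V, S.Nonempty ∧ P = convexHull ℝ (S : Set V)

section GibbsWeights

open Matrix

variable {ι : Type*} [Fintype ι]

/-- The continuous linear functional `x ↦ v ⬝ᵥ x`. -/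
noncomputable def dotProductCLM (v : ι → ℝ) : (ι → ℝ) →L[ℝ] ℝ :=
  LinearMap.toContinuousLinearMap (dotProductBilin ℝ ℝ v)

@[simp]
lemma dotProductCLM_apply (v x : ι → ℝ) : dotProductCLM v x = v ⬝ᵥ x := rfl

/-- The partition function `x ↦ ∑ v ∈ S, exp (v ⬝ᵥ x)`. -/
noncomputable def partitionFn (S : Finset (ι → ℝ)) (x : ι → ℝ) : ℝ :=
  ∑ v ∈ S, Real.exp (v ⬝ᵥ x)

/-- The softmax weight of `v` in `S` at `x`. -/
noncomputable def gibbsWeight (S : Finset (ι → ℝ)) (x v : ι → ℝ) : ℝ :=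
  Real.exp (v ⬝ᵥ x) / partitionFn S x

/-- The softmax mean of `S` at `x`, which is the gradient of `log (partitionFn S)`. -/
noncomputable def gibbsMean (S : Finset (ι → ℝ)) (x : ι → ℝ) : ι → ℝ :=
  ∑ v ∈ S, gibbsWeight S x v • v

/-- The softmax covariance of `S` at `x`, which is the Hessian of `log (partitionFn S)`. -/
noncomputable def gibbsCov (S : Finset (ι → ℝ)) (x : ι → ℝ) : Matrix ι ι ℝ :=
  ∑ v ∈ S, gibbsWeight S x v • vecMulVec (v - gibbsMean S x) (v - gibbsMean S x)

variable {S : Finset (ι → ℝ)}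

lemma partitionFn_pos (hS : S.Nonempty) (x : ι → ℝ) : 0 < partitionFn S x :=
  Finset.sum_pos (fun _ _ => Real.exp_pos _) hS

lemma gibbsWeight_pos (hS : S.Nonempty) (x v : ι → ℝ) : 0 < gibbsWeight S x v :=
  div_pos (Real.exp_pos _) (partitionFn_pos hS x)

lemma sum_gibbsWeight (hS : S.Nonempty) (x : ι → ℝ) : ∑ v ∈ S, gibbsWeight S x v = 1 := by
  simp only [gibbsWeight, ← Finset.sum_div]
  exact div_self (partitionFn_pos hS x).ne'

lemma gibbsMean_mem_convexHull (hS : S.Nonempty) (x : ι → ℝ) :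
    gibbsMean S x ∈ convexHull ℝ (S : Set (ι → ℝ)) :=
  (convex_convexHull ℝ _).sum_mem (fun v _ => (gibbsWeight_pos hS x v).le) (sum_gibbsWeight hS x)
    fun _ hv => subset_convexHull ℝ _ hv

lemma dotProduct_le_log_partitionFn {z : ι → ℝ} (hz : z ∈ convexHull ℝ (S : Set (ι → ℝ)))
    (x : ι → ℝ) : z ⬝ᵥ x ≤ Real.log (partitionFn S x) := by
  have hconv : Convex ℝ {z : ι → ℝ | z ⬝ᵥ x ≤ Real.log (partitionFn S x)} := by
    refine convex_halfSpace_le ⟨fun a b => add_dotProduct _ _ _, fun c a => ?_⟩ _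
    simp
  refine convexHull_min (fun v hv => ?_) hconv hz
  have hle : Real.exp (v ⬝ᵥ x) ≤ partitionFn S x :=
    Finset.single_le_sum (f := fun v => Real.exp (v ⬝ᵥ x)) (fun _ _ => (Real.exp_pos _).le) hv
  exact (Real.le_log_iff_exp_le ((Real.exp_pos _).trans_le hle)).2 hle

lemma hasFDerivAt_exp_dotProduct (v x : ι → ℝ) :
    HasFDerivAt (fun x => Real.exp (v ⬝ᵥ x)) (Real.exp (v ⬝ᵥ x) • dotProductCLM v) x :=
  (dotProductCLM v).hasFDerivAt.exp

lemma hasFDerivAt_partitionFn (hS : S.Nonempty) (x : ι → ℝ) :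
    HasFDerivAt (partitionFn S) (partitionFn S x • dotProductCLM (gibbsMean S x)) x := by
  refine (HasFDerivAt.fun_sum fun v _ => hasFDerivAt_exp_dotProduct v x).congr_fderiv ?_
  ext u
  have hZ := (partitionFn_pos hS x).ne'
  simp [gibbsMean, sum_dotProduct, gibbsWeight, Finset.mul_sum]
  refine Finset.sum_congr rfl fun v _ => ?_
  field_simp

lemma hasFDerivAt_log_partitionFn (hS : S.Nonempty) (x : ι → ℝ) :
    HasFDerivAt (fun x => Real.log (partitionFn S x)) (dotProductCLM (gibbsMean S x)) x := by
  have hZ := (partitionFn_pos hS x).ne'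
  refine ((hasFDerivAt_partitionFn hS x).log hZ).congr_fderiv ?_
  rw [smul_smul, inv_mul_cancel₀ hZ, one_smul]

lemma hasFDerivAt_gibbsWeight (hS : S.Nonempty) (x v : ι → ℝ) :
    HasFDerivAt (fun x => gibbsWeight S x v)
      (gibbsWeight S x v • dotProductCLM (v - gibbsMean S x)) x := by
  have hZ := (partitionFn_pos hS x).ne'
  refine ((hasFDerivAt_exp_dotProduct v x).mul
    ((hasDerivAt_inv hZ).comp_hasFDerivAt x (hasFDerivAt_partitionFn hS x))).congr_fderiv ?_
  ext u
  simp [gibbsWeight, sub_dotProduct]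
  field_simp
  ring

lemma gibbsCov_mulVec (x u : ι → ℝ) :
    gibbsCov S x *ᵥ u =
      ∑ v ∈ S, (gibbsWeight S x v * ((v - gibbsMean S x) ⬝ᵥ u)) • (v - gibbsMean S x) := by
  simp [gibbsCov, sum_mulVec, smul_mulVec, vecMulVec_mulVec, mul_smul, -sub_dotProduct]

lemma sum_gibbsWeight_smul_sub (hS : S.Nonempty) (x : ι → ℝ) :
    ∑ v ∈ S, gibbsWeight S x v • (v - gibbsMean S x) = 0 := by
  simp only [smul_sub, Finset.sum_sub_distrib, ← Finset.sum_smul, sum_gibbsWeight hS, one_smul]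
  exact sub_self _

lemma hasFDerivAt_gibbsMean (hS : S.Nonempty) (x : ι → ℝ) :
    HasFDerivAt (gibbsMean S) (LinearMap.toContinuousLinearMap (gibbsCov S x).mulVecLin) x := by
  refine (HasFDerivAt.fun_sum fun v _ =>
    (hasFDerivAt_gibbsWeight hS x v).smul_const v).congr_fderiv ?_
  ext1 u
  have h0 : ∑ v ∈ S, (gibbsWeight S x v * ((v - gibbsMean S x) ⬝ᵥ u)) • gibbsMean S x = 0 := by
    have := congrArg (· ⬝ᵥ u) (sum_gibbsWeight_smul_sub hS x)
    simp only [sum_dotProduct, smul_dotProduct, zero_dotProduct, smul_eq_mul] at this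
    rw [← Finset.sum_smul, this, zero_smul]
  simp [gibbsCov_mulVec, smul_sub, Finset.sum_sub_distrib, h0, -sub_dotProduct]

lemma dotProduct_gibbsCov_mulVec (x u : ι → ℝ) :
    u ⬝ᵥ (gibbsCov S x *ᵥ u) = ∑ v ∈ S, gibbsWeight S x v * ((v - gibbsMean S x) ⬝ᵥ u) ^ 2 := by
  rw [gibbsCov_mulVec, dotProduct_sum]
  refine Finset.sum_congr rfl fun v _ => ?_
  rw [dotProduct_smul, dotProduct_comm u, smul_eq_mul]
  ring

lemma gibbsCov_isHermitian (x : ι → ℝ) : (gibbsCov S x).IsHermitian := by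
  ext a b
  simp [gibbsCov, Matrix.sum_apply, vecMulVec_apply, mul_comm]

lemma dotProduct_gibbsCov_mulVec_nonneg (hS : S.Nonempty) (x u : ι → ℝ) :
    0 ≤ u ⬝ᵥ (gibbsCov S x *ᵥ u) := by
  rw [dotProduct_gibbsCov_mulVec]
  exact Finset.sum_nonneg fun v _ => mul_nonneg (gibbsWeight_pos hS x v).le (sq_nonneg _)

lemma dotProduct_gibbsCov_mulVec_pos (hS : S.Nonempty) (x : ι → ℝ) {u v w : ι → ℝ}
    (hv : v ∈ S) (hw : w ∈ S) (hvw : v ⬝ᵥ u ≠ w ⬝ᵥ u) :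
    0 < u ⬝ᵥ (gibbsCov S x *ᵥ u) := by
  refine (dotProduct_gibbsCov_mulVec_nonneg hS x u).lt_of_ne' fun h => hvw ?_
  rw [dotProduct_gibbsCov_mulVec, Finset.sum_eq_zero_iff_of_nonneg
    fun v _ => mul_nonneg (gibbsWeight_pos hS x v).le (sq_nonneg _)] at h
  have key : ∀ v ∈ S, v ⬝ᵥ u = gibbsMean S x ⬝ᵥ u := fun v hv => by
    simpa [(gibbsWeight_pos hS x v).ne', sub_dotProduct, sub_eq_zero] using h v hv
  rw [key v hv, key w hw]

lemma gibbsCov_mulVec_eq_zero (hS : S.Nonempty) (x : ι → ℝ) {u : ι → ℝ}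
    (hu : ∀ v ∈ S, ∀ w ∈ S, v ⬝ᵥ u = w ⬝ᵥ u) : gibbsCov S x *ᵥ u = 0 := by
  rw [gibbsCov_mulVec]
  refine Finset.sum_eq_zero fun v hv => ?_
  have hm : gibbsMean S x ⬝ᵥ u = v ⬝ᵥ u := by
    simp only [gibbsMean, sum_dotProduct, smul_dotProduct, smul_eq_mul]
    rw [Finset.sum_congr rfl fun w hw => by rw [hu w hw v hv], ← Finset.sum_mul,
      sum_gibbsWeight hS, one_mul]
  simp [sub_dotProduct, hm]

end GibbsWeights

section MomentMap

open Matrix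

lemma convex_sum_smul_convexHull {ι κ : Type*} [Fintype κ]
    (S : κ → Finset (ι → ℝ)) (lam : κ → ℝ) :
    Convex ℝ (∑ i, lam i • convexHull ℝ (S i : Set (ι → ℝ))) :=
  convex_sum _ fun _ _ => (convex_convexHull ℝ _).smul _

lemma isCompact_sum_smul_convexHull {ι κ : Type*} [Fintype κ]
    (S : κ → Finset (ι → ℝ)) (lam : κ → ℝ) :
    IsCompact (∑ i, lam i • convexHull ℝ (S i : Set (ι → ℝ))) :=
  Finset.sum_induction _ IsCompact (fun _ _ => IsCompact.add) isCompact_singleton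
    fun i _ => ((S i).finite_toSet.isCompact_convexHull ℝ).smul (lam i)

variable {ι κ : Type*} [Fintype ι] [Fintype κ] {S : κ → Finset (ι → ℝ)} {lam : κ → ℝ}

/-- The gradient of `∑ i, lam i * log (partitionFn (S i))`. -/
noncomputable def momentMap (S : κ → Finset (ι → ℝ)) (lam : κ → ℝ) (x : ι → ℝ) : ι → ℝ :=
  ∑ i, lam i • gibbsMean (S i) x

/-- The Hessian of `∑ i, lam i * log (partitionFn (S i))`. -/
noncomputable def momentHessian (S : κ → Finset (ι → ℝ)) (lam : κ → ℝ) (x : ι → ℝ) :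
    Matrix ι ι ℝ :=
  ∑ i, lam i • gibbsCov (S i) x

lemma hasFDerivAt_momentMap (hS : ∀ i, (S i).Nonempty) (lam : κ → ℝ) (x : ι → ℝ) :
    HasFDerivAt (momentMap S lam)
      (LinearMap.toContinuousLinearMap (momentHessian S lam x).mulVecLin) x := by
  refine (HasFDerivAt.fun_sum fun i _ =>
    (hasFDerivAt_gibbsMean (hS i) x).const_smul (lam i)).congr_fderiv ?_
  ext1 u
  simp [momentHessian]

lemma dotProduct_momentHessian_mulVec (x u : ι → ℝ) :
    u ⬝ᵥ (momentHessian S lam x *ᵥ u) = ∑ i, lam i * (u ⬝ᵥ (gibbsCov (S i) x *ᵥ u)) := by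
  simp [momentHessian, sum_mulVec, smul_mulVec, dotProduct_sum]

lemma momentHessian_posSemidef (hS : ∀ i, (S i).Nonempty) (hlam : ∀ i, 0 ≤ lam i) (x : ι → ℝ) :
    (momentHessian S lam x).PosSemidef := by
  refine .of_dotProduct_mulVec_nonneg ?_ fun u => ?_
  · simp only [IsHermitian, momentHessian, conjTranspose_sum, conjTranspose_smul,
      (gibbsCov_isHermitian x).eq, star_trivial]
  · rw [star_trivial, dotProduct_momentHessian_mulVec]
    exact Finset.sum_nonneg fun i _ =>
      mul_nonneg (hlam i) (dotProduct_gibbsCov_mulVec_nonneg (hS i) x u)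

/-- The segments joining points of the same `S i` with `lam i ≠ 0` span the space. -/
def SpansDirections (S : κ → Finset (ι → ℝ)) (lam : κ → ℝ) : Prop :=
  ∀ u : ι → ℝ, u ≠ 0 → ∃ i, lam i ≠ 0 ∧ ∃ v ∈ S i, ∃ w ∈ S i, v ⬝ᵥ u ≠ w ⬝ᵥ u

lemma momentMap_injective (hS : ∀ i, (S i).Nonempty) (hlam : ∀ i, 0 ≤ lam i)
    (h : SpansDirections S lam) : Function.Injective (momentMap S lam) := by
  intro x y hxy
  by_contra hne
  have hu : y - x ≠ 0 := sub_ne_zero.2 (Ne.symm hne)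
  set u := y - x with hu_def
  have hline (t : ℝ) : HasDerivAt (fun t : ℝ => u ⬝ᵥ momentMap S lam (x + t • u))
      (u ⬝ᵥ (momentHessian S lam (x + t • u) *ᵥ u)) t := by
    have h1 : HasDerivAt (fun t : ℝ => x + t • u) u t := by
      simpa using ((hasDerivAt_id t).smul_const u).const_add x
    have h2 : HasDerivAt (fun t : ℝ => momentMap S lam (x + t • u))
        (momentHessian S lam (x + t • u) *ᵥ u) t :=
      HasFDerivAt.comp_hasDerivAt (f := fun t : ℝ => x + t • u) t
        (hasFDerivAt_momentMap hS lam (x + t • u)) h1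
    exact (dotProductCLM u).hasFDerivAt.comp_hasDerivAt t h2
  have hpos (t : ℝ) : 0 < u ⬝ᵥ (momentHessian S lam (x + t • u) *ᵥ u) := by
    obtain ⟨i, hi, v, hv, w, hw, hvw⟩ := h u hu
    rw [dotProduct_momentHessian_mulVec]
    exact Finset.sum_pos'
      (fun j _ => mul_nonneg (hlam j) (dotProduct_gibbsCov_mulVec_nonneg (hS j) _ u))
      ⟨i, Finset.mem_univ i, mul_pos ((hlam i).lt_of_ne' hi)
        (dotProduct_gibbsCov_mulVec_pos (hS i) _ hv hw hvw)⟩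
  have hlt := strictMono_of_hasDerivAt_pos hline hpos zero_lt_one
  simp [hu_def, hxy] at hlt

lemma momentMap_mem (hS : ∀ i, (S i).Nonempty) (lam : κ → ℝ) (x : ι → ℝ) :
    momentMap S lam x ∈ ∑ i, lam i • convexHull ℝ (S i : Set (ι → ℝ)) :=
  Set.finsetSum_mem_finsetSum _ _ _ fun i _ =>
    Set.smul_mem_smul_set (gibbsMean_mem_convexHull (hS i) x)

lemma dotProduct_le_sum_log_partitionFn (hlam : ∀ i, 0 ≤ lam i) {z : ι → ℝ}
    (hz : z ∈ ∑ i, lam i • convexHull ℝ (S i : Set (ι → ℝ))) (x : ι → ℝ) :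
    z ⬝ᵥ x ≤ ∑ i, lam i * Real.log (partitionFn (S i) x) := by
  obtain ⟨g, hg, rfl⟩ := (Set.mem_fintype_sum _ _).1 hz
  rw [sum_dotProduct]
  refine Finset.sum_le_sum fun i _ => ?_
  obtain ⟨w, hw, hwi⟩ := hg i
  rw [← hwi]
  simpa using mul_le_mul_of_nonneg_left (dotProduct_le_log_partitionFn hw x) (hlam i)

lemma interior_subset_range_momentMap (hS : ∀ i, (S i).Nonempty) (hlam : ∀ i, 0 ≤ lam i) :
    interior (∑ i, lam i • convexHull ℝ (S i : Set (ι → ℝ))) ⊆ Set.range (momentMap S lam) := by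
  classical
  intro y hy
  obtain ⟨ε, hε, hball⟩ := Metric.nhds_basis_closedBall.mem_iff.1 (mem_interior_iff_mem_nhds.1 hy)
  set F : (ι → ℝ) → ℝ := fun x => ∑ i, lam i * Real.log (partitionFn (S i) x) - y ⬝ᵥ x with hF
  have hderiv (x : ι → ℝ) : HasFDerivAt F (dotProductCLM (momentMap S lam x - y)) x := by
    refine ((HasFDerivAt.fun_sum fun i _ =>
      (hasFDerivAt_log_partitionFn (hS i) x).const_mul (lam i)).sub
        (dotProductCLM y).hasFDerivAt).congr_fderiv ?_
    ext1 u
    simp [momentMap, sum_dotProduct]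
  have hcoord (x : ι → ℝ) (j : ι) (c : ℝ) (hc : |c| = ε) : c * x j ≤ F x := by
    have hmem : y + Pi.single j c ∈ ∑ i, lam i • convexHull ℝ (S i : Set (ι → ℝ)) := by
      apply hball
      simp [Pi.norm_single, hc]
    have := dotProduct_le_sum_log_partitionFn hlam hmem x
    rw [add_dotProduct, single_dotProduct] at this
    simp only [hF]
    linarith
  have hF0 (x : ι → ℝ) : 0 ≤ F x :=
    sub_nonneg.2 (dotProduct_le_sum_log_partitionFn hlam (interior_subset hy) x)
  have hgrowth (x : ι → ℝ) : ε * ‖x‖ ≤ F x := by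
    rw [← le_div_iff₀' hε, pi_norm_le_iff_of_nonneg (div_nonneg (hF0 x) hε.le)]
    intro j
    rw [le_div_iff₀' hε, Real.norm_eq_abs]
    rcases abs_cases (x j) with ⟨h, _⟩ | ⟨h, _⟩ <;> rw [h]
    · exact hcoord x j ε (abs_of_pos hε)
    · simpa using hcoord x j (-ε) (by rw [abs_neg, abs_of_pos hε])
  have htendsto : Filter.Tendsto F (Filter.cocompact _) Filter.atTop :=
    Filter.tendsto_atTop_mono hgrowth
      ((tendsto_norm_cocompact_atTop (E := ι → ℝ)).const_mul_atTop hε)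
  have hcont : Continuous F := continuous_iff_continuousAt.2 fun x => (hderiv x).continuousAt
  obtain ⟨x, hx⟩ := hcont.exists_forall_le htendsto
  have h0 := IsLocalMin.hasFDerivAt_eq_zero (Filter.Eventually.of_forall hx) (hderiv x)
  refine ⟨x, sub_eq_zero.1 (funext fun j => ?_)⟩
  simpa using congrArg (fun f : (ι → ℝ) →L[ℝ] ℝ => f (Pi.single j 1)) h0

lemma volume_range_momentMap (hS : ∀ i, (S i).Nonempty) (hlam : ∀ i, 0 ≤ lam i) :
    volume (Set.range (momentMap S lam)) =
      volume (∑ i, lam i • convexHull ℝ (S i : Set (ι → ℝ))) := by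
  refine le_antisymm (measure_mono (Set.range_subset_iff.2 (momentMap_mem hS lam))) ?_
  have hfr := (convex_sum_smul_convexHull S lam).addHaar_frontier volume
  rw [← measure_interior_of_null_frontier hfr]
  exact measure_mono (interior_subset_range_momentMap hS hlam)

lemma volume_eq_zero_of_not_spansDirections (h : ¬ SpansDirections S lam) :
    volume (∑ i, lam i • convexHull ℝ (S i : Set (ι → ℝ))) = 0 := by
  simp only [SpansDirections] at h
  push Not at h
  obtain ⟨u, hu, hS⟩ := h
  have hhull (i : κ) (hi : lam i ≠ 0) {v w : ι → ℝ} (hv : v ∈ convexHull ℝ (S i : Set (ι → ℝ)))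
      (hw : w ∈ convexHull ℝ (S i : Set (ι → ℝ))) : v ⬝ᵥ u = w ⬝ᵥ u := by
    obtain ⟨s, hs⟩ := convexHull_nonempty_iff.1 ⟨v, hv⟩
    have key : convexHull ℝ (S i : Set (ι → ℝ)) ⊆ {z | z ⬝ᵥ u = s ⬝ᵥ u} :=
      convexHull_min (fun z hz => hS i hi z hz s hs)
        (convex_hyperplane ⟨fun a b => add_dotProduct _ _ _, fun c a => smul_dotProduct _ _ _⟩ _)
    exact (key hv).trans (key hw).symm
  rcases (∑ i, lam i • convexHull ℝ (S i : Set (ι → ℝ))).eq_empty_or_nonempty with he | ⟨y, hy⟩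
  · rw [he, measure_empty]
  refine measure_mono_null (t := AffineSubspace.mk' y (dotProductCLM u).ker) (fun z hz => ?_)
    (Measure.addHaar_affineSubspace _ _ fun htop => hu ?_)
  · obtain ⟨f, hf, rfl⟩ := (Set.mem_fintype_sum _ _).1 hz
    obtain ⟨g, hg, rfl⟩ := (Set.mem_fintype_sum _ _).1 hy
    have hfg (i : κ) : f i ⬝ᵥ u = g i ⬝ᵥ u := by
      obtain ⟨a, ha, hfa⟩ := hf i
      obtain ⟨b, hb, hgb⟩ := hg i
      rw [← hfa, ← hgb]
      by_cases hi : lam i = 0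
      · simp [hi]
      · simp [hhull i hi ha hb]
    simp [AffineSubspace.mem_mk', dotProduct_comm u, sub_dotProduct, sum_dotProduct, hfg]
  · have hmem : u + y ∈ AffineSubspace.mk' y (dotProductCLM u).ker := htop ▸ AffineSubspace.mem_top ..
    simpa [AffineSubspace.mem_mk'] using hmem

lemma det_momentHessian_eq_zero [DecidableEq ι] (hS : ∀ i, (S i).Nonempty)
    (h : ¬ SpansDirections S lam) (x : ι → ℝ) : (momentHessian S lam x).det = 0 := by
  simp only [SpansDirections] at h
  push Not at h
  obtain ⟨u, hu, hS'⟩ := h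
  refine exists_mulVec_eq_zero_iff.1 ⟨u, hu, ?_⟩
  simp only [momentHessian, sum_mulVec, smul_mulVec]
  refine Finset.sum_eq_zero fun i _ => ?_
  by_cases hi : lam i = 0
  · rw [hi, zero_smul]
  · rw [gibbsCov_mulVec_eq_zero (hS i) x (hS' i hi), smul_zero]

/-- The Hessian determinant of the weighted log-partition function is integrable, with integral the
volume of the weighted Minkowski sum. -/
theorem integrable_det_momentHessian_and_integral_eq [DecidableEq ι] (hS : ∀ i, (S i).Nonempty)
    (hlam : ∀ i, 0 ≤ lam i) :
    Integrable (fun x => (momentHessian S lam x).det) ∧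
      ∫ x, (momentHessian S lam x).det =
        (volume (∑ i, lam i • convexHull ℝ (S i : Set (ι → ℝ)))).toReal := by
  by_cases h : SpansDirections S lam
  · have hderiv (x) (_ : x ∈ Set.univ) :=
      (hasFDerivAt_momentMap hS lam x).hasFDerivWithinAt (s := Set.univ)
    have hinj := (momentMap_injective hS hlam h).injOn (s := Set.univ)
    have hdet (x : ι → ℝ) : |(LinearMap.toContinuousLinearMap
        (momentHessian S lam x).mulVecLin).det| • (1 : ℝ) = (momentHessian S lam x).det := by
      rw [smul_eq_mul, mul_one, abs_of_nonneg] <;>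
        simp [ContinuousLinearMap.det, ← toLin'_apply',
          (momentHessian_posSemidef hS hlam x).det_nonneg]
    have hvol := volume_range_momentMap hS hlam
    constructor
    · have := (integrableOn_image_iff_integrableOn_abs_det_fderiv_smul volume MeasurableSet.univ
        hderiv hinj fun _ => (1 : ℝ)).1 (by
          rw [Set.image_univ]
          refine integrableOn_const ?_
          rw [hvol]
          exact (isCompact_sum_smul_convexHull S lam).measure_lt_top.ne)
      simpa only [hdet, integrableOn_univ] using this
    · have := integral_image_eq_integral_abs_det_fderiv_smul volume MeasurableSet.univ
        hderiv hinj fun _ => (1 : ℝ)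
      simp only [hdet, setIntegral_univ, Set.image_univ] at this
      rw [← this, ← hvol]
      simp [measureReal_def]
  · simp [det_momentHessian_eq_zero hS h, volume_eq_zero_of_not_spansDirections h]

end MomentMap

section PolynomialIntegral

/-- If the values at nonnegative points of a family of homogeneous polynomials are integrable, then
integrating them gives the values of a homogeneous polynomial. -/
theorem exists_isHomogeneous_eval_eq_integral {κ α : Type*} [Fintype κ] [MeasurableSpace α]
    {μ : Measure α} {m : ℕ} {q : α → MvPolynomial κ ℝ} (hq : ∀ x, (q x).IsHomogeneous m)
    (hint : ∀ lam : κ → ℝ, (∀ i, 0 ≤ lam i) → Integrable (fun x => eval lam (q x)) μ) :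
    ∃ p : MvPolynomial κ ℝ, p.IsHomogeneous m ∧
      ∀ lam : κ → ℝ, eval lam p = ∫ x, eval lam (q x) ∂μ := by
  classical
  set D : Finset (κ →₀ ℕ) := Finset.univ.finsuppAntidiag m with hD
  have hmemD (d : κ →₀ ℕ) : d ∈ D ↔ d.degree = m := by
    simp [hD, Finset.mem_finsuppAntidiag, Finsupp.degree_eq_sum]
  have heval (x : α) (lam : κ → ℝ) :
      eval lam (q x) = ∑ d : D, (∏ i, lam i ^ d.1 i) * coeff d.1 (q x) := by
    rw [eval_eq', Finset.sum_coe_sort D fun d => (∏ i, lam i ^ d i) * coeff d (q x)]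
    refine (Finset.sum_subset (fun d hd => ?_) fun d _ hd => ?_).trans
      (Finset.sum_congr rfl fun d _ => mul_comm _ _)
    · rw [hmemD]
      exact of_not_not fun hne => mem_support_iff.1 hd ((hq x).coeff_eq_zero hne)
    · rw [notMem_support_iff.1 hd, zero_mul]
  let V : Submodule ℝ (D → ℝ) :=
    { carrier := {w | Integrable (fun x => ∑ d, w d * coeff d.1 (q x)) μ}
      zero_mem' := by simp
      add_mem' := fun {v w} hv hw => by
        rw [Set.mem_ofPred_eq] at hv hw ⊢
        simp only [Pi.add_apply, add_mul, Finset.sum_add_distrib]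
        exact hv.add hw
      smul_mem' := fun c w hw => by
        rw [Set.mem_ofPred_eq] at hw ⊢
        simp only [Pi.smul_apply, smul_eq_mul, mul_assoc, ← Finset.mul_sum]
        exact hw.const_mul c }
  have hV : V = ⊤ := by
    by_contra hne
    obtain ⟨f, hf, hVf⟩ := Submodule.exists_le_ker_of_lt_top V (lt_top_iff_ne_top.2 hne)
    have hf_apply (w : D → ℝ) : f w = ∑ d, w d * f (Pi.single d 1) := by
      simpa using congrArg f (pi_eq_sum_univ' w)
    have hzero : ∑ d : D, monomial d.1 (f (Pi.single d 1)) = 0 := by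
      refine funext_set (fun _ => Set.Ici (0 : ℝ)) (fun _ => Set.Ici_infinite 0) fun lam hlam => ?_
      have hmem : (fun d : D => ∏ i, lam i ^ d.1 i) ∈ V := by
        have := hint lam fun i => hlam i trivial
        simp only [heval] at this
        exact this
      have := hVf hmem
      rw [LinearMap.mem_ker, hf_apply] at this
      simpa [eval_monomial, Finsupp.prod_fintype, mul_comm] using this
    refine hf (LinearMap.ext fun w => ?_)
    rw [hf_apply, LinearMap.zero_apply]
    refine Finset.sum_eq_zero fun d _ => ?_
    have := congrArg (coeff d.1) hzero
    simp only [coeff_sum, coeff_monomial, Subtype.coe_inj, coeff_zero, Finset.sum_ite_eq',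
      Finset.mem_univ, if_true] at this
    rw [this, mul_zero]
  have hcoeff (d : D) : Integrable (fun x => coeff d.1 (q x)) μ := by
    have : Pi.single d 1 ∈ V := hV ▸ Submodule.mem_top
    simpa [V, Pi.single_apply] using this
  refine ⟨∑ d : D, monomial d.1 (∫ x, coeff d.1 (q x) ∂μ), ?_, fun lam => ?_⟩
  · exact IsHomogeneous.sum _ _ _ fun d _ => isHomogeneous_monomial _ ((hmemD d).1 d.2)
  · simp only [heval]
    rw [integral_finsetSum _ fun d _ => (hcoeff d).const_mul _]
    simp only [map_sum, eval_monomial, integral_const_mul]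
    simp [Finsupp.prod_fintype, mul_comm]

/-- The determinant of a linear combination of matrices is homogeneous in the coefficients. -/
theorem exists_isHomogeneous_eval_eq_det {ι κ R : Type*} [Fintype ι] [DecidableEq ι] [Fintype κ]
    [CommRing R] (A : κ → Matrix ι ι R) :
    ∃ q : MvPolynomial κ R, q.IsHomogeneous (Fintype.card ι) ∧
      ∀ lam : κ → R, eval lam q = (∑ i, lam i • A i).det := by
  refine ⟨(Matrix.of fun a b => ∑ i, C (A i a b) * X i).det, ?_, fun lam => ?_⟩
  · rw [Matrix.det_apply]
    refine IsHomogeneous.sum _ _ _ fun σ _ => ?_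
    rw [Units.smul_def]
    refine zsmul_mem (S := Submodule R (MvPolynomial κ R)) (K := homogeneousSubmodule κ R _) ?_ _
    rw [mem_homogeneousSubmodule]
    convert! IsHomogeneous.prod Finset.univ _ (fun _ => 1) fun a _ => ?_
    · simp
    · exact IsHomogeneous.sum _ _ _ fun i _ => by
        simpa using (isHomogeneous_C κ (A i (σ a) a)).mul (isHomogeneous_X R i)
  · rw [RingHom.map_det]
    congr 1
    ext a b
    simp [Matrix.sum_apply, mul_comm]

end PolynomialIntegral

/-- Minkowski's theorem: for polytopes `P_1, …, P_n ⊆ ℝ^n`, the function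
`(λ_1, …, λ_n) ↦ Vol_n(λ_1 P_1 + … + λ_n P_n)` on nonnegative scalars is
(given by) a homogeneous polynomial of degree `n`. -/
theorem volume_minkowski_sum_is_homogeneous_polynomial (n : ℕ) (hn : 1 ≤ n)
    (P : Fin n → Set (Fin n → ℝ)) (hP : ∀ i, IsPolytope (P i)) :
    ∃ p : MvPolynomial (Fin n) ℝ, p.IsHomogeneous n ∧
      ∀ lam : Fin n → ℝ, (∀ i, 0 ≤ lam i) →
        MvPolynomial.eval lam p = (volume (∑ i : Fin n, lam i • P i)).toReal := by
  choose S hS hPS using hP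
  choose q hq hqe using fun x => exists_isHomogeneous_eval_eq_det fun i => gibbsCov (S i) x
  have hint (lam : Fin n → ℝ) (hlam : ∀ i, 0 ≤ lam i) :=
    integrable_det_momentHessian_and_integral_eq hS hlam
  simp only [momentHessian, ← hqe] at hint
  obtain ⟨p, hp, hpe⟩ := exists_isHomogeneous_eval_eq_integral (μ := volume) hq
    fun lam hlam => (hint lam hlam).1
  rw [Fintype.card_fin] at hp
  refine ⟨p, hp, fun lam hlam => ?_⟩
  simp only [hpe, (hint lam hlam).2, hPS]
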